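/- (Lemma 1(ii).) Let p, p' have nonnegative entries and suppose β_m·Ξ_m(q) ≤ μ₀ for every q on the line segment joining p and p'. Then ‖∇_p Ξ_m(p) − ∇_p Ξ_m(p')‖_∞ ≤ (L₁ᵐ/β_m)·‖p − p'‖₂, where L₁ᵐ = max_{1≤k≤K} (β_m a_m b_m ξBT G_{k,k}/(D_m ln 2 · σ⁴))·(μ₀/(β_m a_m))^{1+1/b_m}·[G_{k,k} + ((b_m+1)ξBT H_m/(D_m ln 2))·(μ₀/(β_m a_m))^{1/b_m}]. -/

import Mathlib

open Finset

/-- Total number of collected samples (minus A_m) of task m in the asymptotic regime: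
Σ_{k∈Y} (ξBT/D_m) log₂(1 + G_kk p_k/σ²). -/
noncomputable def Srate {K : ℕ} (G : Fin K → ℝ) (σ2 ξ B T Dm : ℝ)
    (Y : Finset (Fin K)) (p : Fin K → ℝ) : ℝ :=
  ∑ k ∈ Y, ξ * B * T / Dm * Real.logb 2 (1 + G k * p k / σ2)

/-- Asymptotic classification error Ξ_m(p) of task m. -/
noncomputable def Xi {K : ℕ} (G : Fin K → ℝ) (σ2 ξ B T Dm Am am bm : ℝ)
    (Y : Finset (Fin K)) (p : Fin K → ℝ) : ℝ :=
  am * (Srate G σ2 ξ B T Dm Y p + Am) ^ (-bm)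

/-- Partial derivative ∂Ξ_m/∂p_j (closed form, eq. (24) of the paper). -/
noncomputable def dXi {K : ℕ} (G : Fin K → ℝ) (σ2 ξ B T Dm Am am bm : ℝ)
    (Y : Finset (Fin K)) (p : Fin K → ℝ) (j : Fin K) : ℝ :=
  -(am * bm * (ξ * B * T) * (if j ∈ Y then (1 : ℝ) else 0)
      / (Dm * Real.log 2 * (σ2 / G j + p j)))
    * (Srate G σ2 ξ B T Dm Y p + Am) ^ (-bm - 1)

/-- The constant H_m = ‖(𝟙_{Y}(1) G_11, …, 𝟙_{Y}(K) G_KK)‖₂. -/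
noncomputable def Hconst {K : ℕ} (G : Fin K → ℝ) (Y : Finset (Fin K)) : ℝ :=
  Real.sqrt (∑ j, (if j ∈ Y then G j else 0) ^ 2)

theorem aux_rpow (s r x y : ℝ) (hs : 0 < s) (hr : 0 < r) (hx : s ≤ x) (hy : s ≤ y) :
    |x ^ (-r) - y ^ (-r)| ≤ r * s ^ (-r - 1) * |x - y| := by
  have h := Convex.norm_image_sub_le_of_norm_hasDerivWithin_le (𝕜 := ℝ)
    (f := fun z : ℝ => z ^ (-r)) (f' := fun z => (-r) * z ^ (-r - 1)) (s := Set.Ici s)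
    (C := r * s ^ (-r - 1)) (x := y) (y := x) ?_ ?_ (convex_Ici s) hy hx
  · simpa [Real.norm_eq_abs] using h
  · intro z hz
    have hz0 : 0 < z := lt_of_lt_of_le hs hz
    exact (Real.hasDerivAt_rpow_const (Or.inl hz0.ne')).hasDerivWithinAt
  · intro z hz
    have hz0 : 0 < z := lt_of_lt_of_le hs hz
    rw [norm_mul, Real.norm_eq_abs, Real.norm_eq_abs, abs_neg, abs_of_pos hr,
      abs_of_pos (Real.rpow_pos_of_pos hz0 _)]
    exact mul_le_mul_of_nonneg_left
      (Real.rpow_le_rpow_of_nonpos hs hz (by linarith)) hr.le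

theorem aux_log1 (a b : ℝ) (ha : 1 ≤ a) (hb : 1 ≤ b) :
    Real.log a - Real.log b ≤ |a - b| := by
  have hb0 : 0 < b := by linarith
  have ha0 : 0 < a := by linarith
  rw [← Real.log_div ha0.ne' hb0.ne']
  have h1 := Real.log_le_sub_one_of_pos (div_pos ha0 hb0)
  have h2 : a / b - 1 = (a - b) / b := by field_simp
  have h3 : (a - b) / b ≤ |a - b| / b := by gcongr; exact le_abs_self _
  have h4 : |a - b| / b ≤ |a - b| := div_le_self (abs_nonneg _) hb
  linarith

theorem aux_log (a b : ℝ) (ha : 1 ≤ a) (hb : 1 ≤ b) :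
    |Real.log a - Real.log b| ≤ |a - b| := by
  rw [abs_le']
  refine ⟨aux_log1 a b ha hb, ?_⟩
  have := aux_log1 b a hb ha
  rw [abs_sub_comm] at this
  linarith

theorem aux_S {K : ℕ} (G : Fin K → ℝ) (σ2 ξ B T Dm : ℝ) (Y : Finset (Fin K))
    (p p' : Fin K → ℝ) (hG : ∀ k, 0 < G k) (hσ : 0 < σ2) (hξ : 0 < ξ) (hB : 0 < B)
    (hT : 0 < T) (hD : 0 < Dm) (hp : ∀ k, 0 ≤ p k) (hp' : ∀ k, 0 ≤ p' k) :
    |Srate G σ2 ξ B T Dm Y p - Srate G σ2 ξ B T Dm Y p'| ≤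
      ξ * B * T / (Dm * Real.log 2 * σ2) * (Hconst G Y * Real.sqrt (∑ k, (p k - p' k) ^ 2)) := by
  have hl : 0 < Real.log 2 := Real.log_pos (by norm_num)
  have hc : 0 < ξ * B * T := by positivity
  have key : ∀ k, |Real.log (1 + G k * p k / σ2) - Real.log (1 + G k * p' k / σ2)|
      ≤ G k * |p k - p' k| / σ2 := by
    intro k
    have h1 : 0 ≤ G k * p k / σ2 := div_nonneg (mul_nonneg (hG k).le (hp k)) hσ.le
    have h2 : 0 ≤ G k * p' k / σ2 := div_nonneg (mul_nonneg (hG k).le (hp' k)) hσ.le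
    refine (aux_log _ _ (by linarith) (by linarith)).trans (le_of_eq ?_)
    rw [show 1 + G k * p k / σ2 - (1 + G k * p' k / σ2) = G k * (p k - p' k) / σ2 by ring,
      abs_div, abs_mul, abs_of_pos hσ, abs_of_pos (hG k)]
  have hCS : ∑ k ∈ Y, G k * |p k - p' k| ≤ Hconst G Y * Real.sqrt (∑ k, (p k - p' k) ^ 2) := by
    have h := Real.sum_mul_le_sqrt_mul_sqrt Finset.univ
      (fun k => if k ∈ Y then G k else 0) (fun k => |p k - p' k|)
    simpa [Hconst, ite_mul, Finset.sum_ite_mem] using h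
  unfold Srate
  rw [← Finset.sum_sub_distrib]
  calc _ ≤ ∑ k ∈ Y, |ξ * B * T / Dm * Real.logb 2 (1 + G k * p k / σ2)
            - ξ * B * T / Dm * Real.logb 2 (1 + G k * p' k / σ2)| :=
        Finset.abs_sum_le_sum_abs _ _
    _ ≤ ∑ k ∈ Y, ξ * B * T / (Dm * Real.log 2 * σ2) * (G k * |p k - p' k|) := by
        refine Finset.sum_le_sum fun k _ => ?_
        have h : ξ * B * T / Dm * Real.logb 2 (1 + G k * p k / σ2)
            - ξ * B * T / Dm * Real.logb 2 (1 + G k * p' k / σ2)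
            = ξ * B * T / (Dm * Real.log 2) *
              (Real.log (1 + G k * p k / σ2) - Real.log (1 + G k * p' k / σ2)) := by
          unfold Real.logb
          generalize Real.log (1 + G k * p k / σ2) = u
          generalize Real.log (1 + G k * p' k / σ2) = v
          field_simp
        rw [h, abs_mul, abs_of_pos (by positivity)]
        calc _ ≤ ξ * B * T / (Dm * Real.log 2) * (G k * |p k - p' k| / σ2) := by
              gcongr; exact key k
          _ = _ := by field_simp
    _ = ξ * B * T / (Dm * Real.log 2 * σ2) * ∑ k ∈ Y, (G k * |p k - p' k|) := by
        rw [Finset.mul_sum]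
    _ ≤ _ := by gcongr

theorem aux_Snonneg {K : ℕ} (G : Fin K → ℝ) (σ2 ξ B T Dm : ℝ) (Y : Finset (Fin K))
    (p : Fin K → ℝ) (hG : ∀ k, 0 < G k) (hσ : 0 < σ2) (hξ : 0 < ξ) (hB : 0 < B)
    (hT : 0 < T) (hD : 0 < Dm) (hp : ∀ k, 0 ≤ p k) :
    0 ≤ Srate G σ2 ξ B T Dm Y p := by
  refine Finset.sum_nonneg fun k _ => mul_nonneg (by positivity) ?_
  have h1 : 0 ≤ G k * p k / σ2 := div_nonneg (mul_nonneg (hG k).le (hp k)) hσ.le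
  exact Real.logb_nonneg (by norm_num) (by linarith)

theorem aux_lower (S b a β μ : ℝ) (hS : 0 < S) (hb : 0 < b) (ha : 0 < a) (hβ : 0 < β)
    (hμ : 0 < μ) (h : β * (a * S ^ (-b)) ≤ μ) : (μ / (β * a)) ^ (-(1 / b)) ≤ S := by
  have h1 : S ^ (-b) ≤ μ / (β * a) := by
    rw [le_div_iff₀ (by positivity)]; linarith
  have h2 := Real.rpow_le_rpow_of_nonpos (Real.rpow_pos_of_pos hS _) h1
    (show -(1 / b) ≤ 0 by rw [neg_nonpos]; positivity)
  rwa [← Real.rpow_mul hS.le, show -b * -(1 / b) = 1 by field_simp, Real.rpow_one] at h2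

theorem aux_u (g σ x : ℝ) (hg : 0 < g) (hσ : 0 < σ) (hx : 0 ≤ x) :
    1 / (σ / g + x) ≤ g / σ := by
  have : 0 < σ / g := by positivity
  calc 1 / (σ / g + x) ≤ 1 / (σ / g) := by gcongr; linarith
    _ = g / σ := by field_simp

theorem aux_du (g σ x y : ℝ) (hg : 0 < g) (hσ : 0 < σ) (hx : 0 ≤ x) (hy : 0 ≤ y) :
    |1 / (σ / g + x) - 1 / (σ / g + y)| ≤ (g / σ) * (g / σ) * |x - y| := by
  have h0 : 0 < σ / g := by positivity
  have h : 1 / (σ / g + x) - 1 / (σ / g + y)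
      = 1 / (σ / g + x) * (1 / (σ / g + y)) * (y - x) := by
    have h1 : σ / g + x ≠ 0 := by positivity
    have h2 : σ / g + y ≠ 0 := by positivity
    generalize σ / g = w at *
    field_simp
    ring
  rw [h, abs_mul, abs_of_pos (by positivity), abs_sub_comm y x]
  have := aux_u g σ x hg hσ hx
  have := aux_u g σ y hg hσ hy
  gcongr

/-- Lemma 1(ii): Lipschitz bound, sup-norm vs Euclidean norm, for the
gradient of Ξ_m, with constant L₁ᵐ/β_m. -/
theorem gradXi_lipschitz {K : ℕ} [NeZero K]
    (G : Fin K → ℝ) (σ2 ξ B T Dm Am am bm βm μ0 : ℝ) (Y : Finset (Fin K))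
    (p p' : Fin K → ℝ)
    (hG : ∀ k, 0 < G k) (hσ : 0 < σ2) (hξ : 0 < ξ) (hB : 0 < B) (hT : 0 < T)
    (hD : 0 < Dm) (hA : 0 < Am) (ha : 0 < am) (hb : 0 < bm) (hβ : 1 ≤ βm)
    (hμ0 : 0 < μ0) (hY : Y.Nonempty) (hp : ∀ k, 0 ≤ p k) (hp' : ∀ k, 0 ≤ p' k)
    (hseg : ∀ q ∈ segment ℝ p p', βm * Xi G σ2 ξ B T Dm Am am bm Y q ≤ μ0) :
    ‖(fun j => dXi G σ2 ξ B T Dm Am am bm Y p j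
        - dXi G σ2 ξ B T Dm Am am bm Y p' j : Fin K → ℝ)‖
      ≤ (Finset.univ.sup' Finset.univ_nonempty (fun k =>
            βm * am * bm * (ξ * B * T) * G k / (Dm * Real.log 2 * σ2 ^ 2)
              * (μ0 / (βm * am)) ^ (1 + 1 / bm)
              * (G k + (bm + 1) * (ξ * B * T) * Hconst G Y / (Dm * Real.log 2)
                  * (μ0 / (βm * am)) ^ (1 / bm)))) / βm
        * Real.sqrt (∑ k, (p k - p' k) ^ 2) := by
  have hl : 0 < Real.log 2 := Real.log_pos (by norm_num)
  have hc : 0 < ξ * B * T := by positivity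
  have hβ0 : 0 < βm := by linarith
  have hH : 0 ≤ Hconst G Y := Real.sqrt_nonneg _
  have hS := aux_S G σ2 ξ B T Dm Y p p' hG hσ hξ hB hT hD hp hp'
  have hSp := aux_Snonneg G σ2 ξ B T Dm Y p hG hσ hξ hB hT hD hp
  have hSp' := aux_Snonneg G σ2 ξ B T Dm Y p' hG hσ hξ hB hT hD hp'
  have hL := aux_lower (Srate G σ2 ξ B T Dm Y p + Am) bm am βm μ0 (by linarith) hb ha hβ0 hμ0
    (hseg p (left_mem_segment ℝ p p'))
  have hL' := aux_lower (Srate G σ2 ξ B T Dm Y p' + Am) bm am βm μ0 (by linarith) hb ha hβ0 hμ0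
    (hseg p' (right_mem_segment ℝ p p'))
  set N := Real.sqrt (∑ k, (p k - p' k) ^ 2) with hN
  have hN0 : 0 ≤ N := Real.sqrt_nonneg _
  set M := μ0 / (βm * am) with hM
  have hM0 : 0 < M := by positivity
  set H := Hconst G Y
  set c := ξ * B * T
  have hs0 : 0 < M ^ (-(1 / bm)) := Real.rpow_pos_of_pos hM0 _
  have hV := aux_rpow _ (bm + 1) _ _ hs0 (by linarith) hL hL'
  have hVb := Real.rpow_le_rpow_of_nonpos hs0 hL (show -(bm + 1) ≤ 0 by linarith)
  have e1 : (M ^ (-(1 / bm))) ^ (-(bm + 1)) = M ^ (1 + 1 / bm) := by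
    rw [← Real.rpow_mul hM0.le]; congr 1; field_simp
  have e2 : (M ^ (-(1 / bm))) ^ (-(bm + 1) - 1) = M ^ (1 + 1 / bm) * M ^ (1 / bm) := by
    rw [← Real.rpow_mul hM0.le, ← Real.rpow_add hM0]; congr 1; field_simp; ring
  rw [e1] at hVb
  rw [e2, add_sub_add_right_eq_sub] at hV
  have hV0 : 0 < (Srate G σ2 ξ B T Dm Y p + Am) ^ (-(bm + 1)) :=
    Real.rpow_pos_of_pos (by linarith) _
  have hP : 0 < M ^ (1 + 1 / bm) := Real.rpow_pos_of_pos hM0 _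
  have hQ : 0 < M ^ (1 / bm) := Real.rpow_pos_of_pos hM0 _
  set P := M ^ (1 + 1 / bm)
  set Q := M ^ (1 / bm)
  set F : Fin K → ℝ := fun k => βm * am * bm * c * G k / (Dm * Real.log 2 * σ2 ^ 2) * P
              * (G k + (bm + 1) * c * H / (Dm * Real.log 2) * Q) with hF
  have hF0 : ∀ k, 0 ≤ F k := by
    intro k
    have := hG k
    simp only [hF]
    positivity
  have hle : ∀ j, F j ≤ Finset.univ.sup' Finset.univ_nonempty F := fun j =>
    Finset.le_sup' F (Finset.mem_univ j)
  have hfin : ∀ j, F j / βm * N ≤ Finset.univ.sup' Finset.univ_nonempty F / βm * N := by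
    intro j
    have := hle j
    gcongr
  have hR : ∀ j, 0 ≤ F j / βm * N := fun j => by have := hF0 j; positivity
  rw [pi_norm_le_iff_of_nonneg ((hR 0).trans (hfin 0))]
  intro j
  refine le_trans ?_ (hfin j)
  by_cases hj : j ∈ Y
  swap
  · simpa [dXi, hj] using hR j
  have hg := hG j
  have hu' := aux_u (G j) σ2 (p' j) hg hσ (hp' j)
  have hdu := aux_du (G j) σ2 (p j) (p' j) hg hσ (hp j) (hp' j)
  have hu0 : 0 < 1 / (σ2 / G j + p' j) := by have := hp' j; positivity
  have hdN : |p j - p' j| ≤ N := by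
    rw [← Real.sqrt_sq_eq_abs]
    exact Real.sqrt_le_sqrt (Finset.single_le_sum (f := fun k => (p k - p' k) ^ 2)
      (fun i _ => sq_nonneg _) (Finset.mem_univ j))
  have ex : ∀ q : Fin K → ℝ, dXi G σ2 ξ B T Dm Am am bm Y q j
      = -(am * bm * c / (Dm * Real.log 2)) * ((1 / (σ2 / G j + q j)) *
        (Srate G σ2 ξ B T Dm Y q + Am) ^ (-(bm + 1))) := by
    intro q
    unfold dXi
    rw [if_pos hj, show -bm - 1 = -(bm + 1) by ring, mul_one, ← div_div]
    simp only [c]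
    ring
  rw [ex, ex, Real.norm_eq_abs, ← mul_sub, abs_mul, abs_neg, abs_of_pos (by positivity)]
  generalize 1 / (σ2 / G j + p j) = u at *
  generalize 1 / (σ2 / G j + p' j) = u' at *
  generalize (Srate G σ2 ξ B T Dm Y p + Am) ^ (-(bm + 1)) = v at *
  generalize (Srate G σ2 ξ B T Dm Y p' + Am) ^ (-(bm + 1)) = v' at *
  have hmain : |u * v - u' * v'| ≤ (G j / σ2) * (G j / σ2) * N * P
      + (G j / σ2) * ((bm + 1) * (P * Q) * (c / (Dm * Real.log 2 * σ2) * (H * N))) := by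
    rw [show u * v - u' * v' = (u - u') * v + u' * (v - v') by ring]
    refine (abs_add_le _ _).trans ?_
    rw [abs_mul, abs_mul, abs_of_pos hV0, abs_of_pos hu0]
    have h1 : |u - u'| ≤ (G j / σ2) * (G j / σ2) * N := hdu.trans (by gcongr)
    have h2 : |v - v'| ≤ (bm + 1) * (P * Q) * (c / (Dm * Real.log 2 * σ2) * (H * N)) :=
      hV.trans (by gcongr)
    gcongr
  calc _ ≤ am * bm * c / (Dm * Real.log 2) * ((G j / σ2) * (G j / σ2) * N * P
      + (G j / σ2) * ((bm + 1) * (P * Q) * (c / (Dm * Real.log 2 * σ2) * (H * N)))) := by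
        gcongr
    _ = F j / βm * N := by
        simp only [hF]
        clear_value P Q H c N
        field_simp
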